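/- Let X be a normal random variable with mean μ and variance σ² > 0, let n ≥ 1 and 0 ≤ m₁ < m₂ be integers, ℓ = max{m₂, n}, and let g : ℝ → ℝ be (ℓ−1)-times continuously differentiable with g^{(ℓ−1)} absolutely continuous (a.e. derivative g^{(ℓ)}), E[(g^{(n)}(X))²] < ∞, and E|g^{(i)}(X)| < ∞ for i = n+1, …, m₂. With S_{m,n}(g) = Σ_{i=1}^{m} (C(m,i) σ^{2i}/(m+n)_i)(E[g^{(i)}(X)])² + Σ_{i=1}^{n} (−1)^{i−1}(C(n,i) σ^{2i}/(m+n)_i) E[(g^{(i)}(X))²], one has |Var[g(X)] − S_{m₁,n}(g)| ≥ ((m₂+n)_n/(m₁+n)_n) · |Var[g(X)] − S_{m₂,n}(g)|, with equality if and only if g is a polynomial of degree at most n+m₁. -/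

import Mathlib

open MeasureTheory ProbabilityTheory Finset Filter

noncomputable section

/-- Falling factorial `(x)_k = x (x-1) ⋯ (x-k+1)`, with `(x)_0 = 1`. -/
def fall (x : ℝ) (k : ℕ) : ℝ := ∏ j ∈ Finset.range k, (x - j)

/-- Rising factorial `[x]_k = x (x+1) ⋯ (x+k-1)`, with `[x]_0 = 1`. -/
def rise (x : ℝ) (k : ℕ) : ℝ := ∏ j ∈ Finset.range k, (x + j)

/-- The product `∏_{j=a}^{a+len-1} (1 - j δ)` of `len` consecutive factors
(an empty product is `1`). -/
def pp (δ a : ℝ) (len : ℕ) : ℝ := ∏ j ∈ Finset.range len, (1 - (a + j) * δ)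

/-- The open real interval with (possibly infinite) endpoints `α ω : EReal`. -/
def erealIoo (α ω : EReal) : Set ℝ := {x : ℝ | α < (x : EReal) ∧ (x : EReal) < ω}

/-- `g` coincides on `J` with a polynomial of degree at most `d`. -/
def IsPolyOn (g : ℝ → ℝ) (J : Set ℝ) (d : ℕ) : Prop :=
  ∃ p : Polynomial ℝ, p.natDegree ≤ d ∧ ∀ x ∈ J, g x = p.eval x

/-- The quadratic `q(x) = δ x² + β x + γ` of a Pearson family. -/
def pq (δ β γ : ℝ) : ℝ → ℝ := fun x => δ * x ^ 2 + β * x + γ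

/-- `P` is the distribution of a random variable with density `f` (w.r.t. Lebesgue
measure) belonging to the integrated Pearson family `IP(μ; δ, β, γ)`:
`μ` is the (finite) mean of `P`, `|δ|+|β|+|γ| > 0`, and
`∫_{-∞}^x (μ - t) f(t) dt = q(x) f(x)` for all `x`. -/
def IsIntegratedPearson (P : Measure ℝ) (f : ℝ → ℝ) (μ δ β γ : ℝ) : Prop :=
  IsProbabilityMeasure P ∧
  (∀ x, 0 ≤ f x) ∧
  P = volume.withDensity (fun x => ENNReal.ofReal (f x)) ∧
  Integrable (fun x : ℝ => x) P ∧
  μ = ∫ x, x ∂P ∧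
  0 < |δ| + |β| + |γ| ∧
  ∀ x : ℝ, (∫ t in Set.Iic x, (μ - t) * f t) = pq δ β γ x * f x

/-- Membership in the class `H^{m,n}(X)` for the distribution `P` of `X` with Pearson
quadratic `q` and support `J`.  Here `gd k` plays the role of the `k`-th derivative
`g^{(k)}` of `g = gd 0` on `J`.  With `ℓ = max m n`:  `g ∈ C^{ℓ-1}(J)`
(encoded by `gd k` having derivative `gd (k+1)` at every point of `J` for `k+1 < ℓ`,
and `gd (ℓ-1)` continuous on `J`), `g^{(ℓ-1)}` is absolutely continuous on `J` with
a.e. derivative `g^{(ℓ)} = gd ℓ` (encoded by the fundamental theorem of calculus: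
`gd ℓ` is locally integrable and `gd (ℓ-1)` is its integral on every subinterval of `J`),
and the moment conditions `E[q(X)^n (g^{(n)}(X))²] < ∞` and
`E[q(X)^i |g^{(i)}(X)|] < ∞` for `n < i ≤ m` hold. -/
def MemH (P : Measure ℝ) (q : ℝ → ℝ) (J : Set ℝ) (m n : ℕ) (gd : ℕ → ℝ → ℝ) : Prop :=
  (∀ k, k + 1 < max m n → ∀ x ∈ J, HasDerivAt (gd k) (gd (k + 1) x) x) ∧
  (1 ≤ max m n → ContinuousOn (gd (max m n - 1)) J) ∧
  (1 ≤ max m n → ∀ a ∈ J, ∀ b ∈ J,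
    IntervalIntegrable (gd (max m n)) volume a b ∧
      gd (max m n - 1) b - gd (max m n - 1) a = ∫ t in a..b, gd (max m n) t) ∧
  Integrable (fun x => q x ^ n * (gd n x) ^ 2) P ∧
  ∀ i, n < i → i ≤ m → Integrable (fun x => q x ^ i * |gd i x|) P

/-- The variance bound `S_{m,n}(g)` of Theorem 2.1, for a Pearson distribution `P`
with quadratic `q` and parameter `δ`. -/
def Sbound (P : Measure ℝ) (δ : ℝ) (q : ℝ → ℝ) (m n : ℕ) (gd : ℕ → ℝ → ℝ) : ℝ :=
  (∑ i ∈ Finset.Icc 1 m,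
      ((m.choose i : ℝ) * pp δ ((m : ℝ) + i) n /
          (fall ((m : ℝ) + n) i * (∫ x, q x ^ i ∂P) * pp δ ((i : ℝ) - 1) i *
            pp δ (m : ℝ) n)) *
        (∫ x, q x ^ i * gd i x ∂P) ^ 2) +
    ∑ i ∈ Finset.Icc 1 n,
      (-1 : ℝ) ^ (i - 1) *
          ((n.choose i : ℝ) / (fall ((m : ℝ) + n) i * pp δ (m : ℝ) i)) *
        ∫ x, q x ^ i * (gd i x) ^ 2 ∂P

/-- The density of the normal distribution `N(μ, σ²)`. -/
def normalDensity (μ σ : ℝ) : ℝ → ℝ := fun x =>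
  (Real.sqrt (2 * Real.pi) * σ)⁻¹ * Real.exp (-(x - μ) ^ 2 / (2 * σ ^ 2))

/-- The bound `S_{m,n}(g)` specialized to the normal distribution `N(μ, σ²)`. -/
def SnormalBound (P : Measure ℝ) (σ : ℝ) (m n : ℕ) (gd : ℕ → ℝ → ℝ) : ℝ :=
  (∑ i ∈ Finset.Icc 1 m,
      (m.choose i : ℝ) * σ ^ (2 * i) / fall ((m : ℝ) + n) i * (∫ x, gd i x ∂P) ^ 2) +
    ∑ i ∈ Finset.Icc 1 n,
      (-1 : ℝ) ^ (i - 1) * ((n.choose i : ℝ) * σ ^ (2 * i) / fall ((m : ℝ) + n) i) *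
        ∫ x, (gd i x) ^ 2 ∂P

/-- standard Gaussian measure -/
abbrev gam : Measure ℝ := gaussianReal 0 1

/-- standard Gaussian density -/
def phi (x : ℝ) : ℝ := gaussianPDFReal 0 1 x

/-- `f` is a primitive of `f'` (absolutely continuous). -/
def IsPrim (f f' : ℝ → ℝ) : Prop :=
  ∀ a b : ℝ, IntervalIntegrable f' volume a b ∧ f b - f a = ∫ t in a..b, f' t

lemma phi_pos (x : ℝ) : 0 < phi x := gaussianPDFReal_pos 0 1 x one_ne_zero

lemma phi_hasDeriv (x : ℝ) : HasDerivAt phi (-x * phi x) x := by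
  have h : phi = fun x => (Real.sqrt (2 * Real.pi))⁻¹ * Real.exp (-x ^ 2 / 2) := by
    ext y; simp [phi, gaussianPDFReal]
  rw [h]
  have h1 : HasDerivAt (fun x : ℝ => -x ^ 2 / 2) (-x) x := by
    have := ((hasDerivAt_pow 2 x).neg.div_const 2)
    refine this.congr_deriv ?_
    simp
    ring
  have := (h1.exp).const_mul (Real.sqrt (2 * Real.pi))⁻¹
  refine this.congr_deriv ?_
  ring

lemma phi_cont : Continuous phi :=
  continuous_iff_continuousAt.2 fun x => (phi_hasDeriv x).continuousAt

lemma gam_integrable_iff (f : ℝ → ℝ) :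
    Integrable f gam ↔ Integrable (fun x => f x * phi x) volume := by
  rw [gam, gaussianReal_of_var_ne_zero _ one_ne_zero]
  have := integrable_withDensity_iff (μ := (volume : Measure ℝ)) (f := gaussianPDF 0 1)
    (measurable_gaussianPDF 0 1) (Eventually.of_forall fun x => gaussianPDF_lt_top) (g := f)
  rw [this]
  simp [phi]

lemma gam_integral (f : ℝ → ℝ) : ∫ x, f x ∂gam = ∫ x, f x * phi x := by
  rw [gam, integral_gaussianReal_eq_integral_smul one_ne_zero]
  simp [phi, mul_comm]

lemma IsPrim.intInt {f f' : ℝ → ℝ} (h : IsPrim f f') (a b : ℝ) :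
    IntervalIntegrable f' volume a b := (h a b).1

lemma IsPrim.locInt {f f' : ℝ → ℝ} (h : IsPrim f f') : LocallyIntegrable f' volume := by
  rw [locallyIntegrable_iff]
  intro k hk
  obtain ⟨R, hR⟩ := hk.isBounded.subset_closedBall 0
  have := (h (-|R|) (|R|)).1
  rw [intervalIntegrable_iff_integrableOn_Icc_of_le (by linarith [abs_nonneg R])] at this
  refine this.mono_set fun x hx => ?_
  have := hR hx
  rw [Metric.mem_closedBall, dist_zero_right, Real.norm_eq_abs] at this
  exact ⟨by linarith [neg_abs_le x, le_abs_self R], by linarith [le_abs_self x, le_abs_self R]⟩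

lemma IsPrim.of_locInt {f' : ℝ → ℝ} (h : ∀ a b, IntervalIntegrable f' volume a b) (c : ℝ) :
    IsPrim (fun x => ∫ t in c..x, f' t) f' := fun a b =>
  ⟨h a b, by
    rw [sub_eq_iff_eq_add, add_comm]
    exact (intervalIntegral.integral_add_adjacent_intervals (h _ _) (h _ _)).symm⟩

lemma IsPrim.cont {f f' : ℝ → ℝ} (h : IsPrim f f') : Continuous f := by
  have : f = fun x => f 0 + ∫ t in (0:ℝ)..x, f' t := by
    ext x; rw [← (h 0 x).2]; ring
  rw [this]
  exact continuous_const.add (intervalIntegral.continuous_primitive (fun a b => (h a b).1) 0)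

lemma IsPrim.of_hasDeriv {f f' : ℝ → ℝ} (h : ∀ x, HasDerivAt f (f' x) x) (hc : Continuous f') :
    IsPrim f f' := fun a b =>
  ⟨hc.intervalIntegrable _ _, by
    rw [intervalIntegral.integral_eq_sub_of_hasDerivAt (fun x _ => h x)
      (hc.intervalIntegrable _ _)]⟩

lemma IsPrim.refl {f f' : ℝ → ℝ} (h : IsPrim f f') :
    IsPrim (fun x => f (-x)) (fun x => -f' (-x)) := fun a b => by
  refine ⟨?_, ?_⟩
  · have := (h (-a) (-b)).1
    have := this.comp_mul_left (c := -1)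
    simp at this
    exact this.neg
  · simp only [intervalIntegral.integral_neg, intervalIntegral.integral_comp_neg]
    rw [(h (-a) (-b)).2, intervalIntegral.integral_symm]

/-- interval integration by parts -/
lemma IsPrim.ibp {f f' u u' : ℝ → ℝ} (h : IsPrim f f') (hu : ∀ x, HasDerivAt u (u' x) x)
    (hu' : Continuous u') (a b : ℝ) :
    ∫ t in a..b, f' t * u t = f b * u b - f a * u a - ∫ t in a..b, f t * u' t := by
  have hfac : AbsolutelyContinuousOnInterval f a b := by
    have h1 := (h a b).1.absolutelyContinuousOnInterval_intervalIntegral (c := a) (by simp)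
    have h2 : AbsolutelyContinuousOnInterval (fun _ : ℝ => f a) a b :=
      ContDiffOn.absolutelyContinuousOnInterval contDiffOn_const
    have e : f = (fun _ : ℝ => f a) + fun x => ∫ v in a..x, f' v := by
      funext x
      simp only [Pi.add_apply]
      rw [← (h a x).2]; ring
    rw [e]
    exact h2.add h1
  have huc : ContDiff ℝ 1 u := by
    rw [contDiff_one_iff_deriv]
    refine ⟨fun x => (hu x).differentiableAt, ?_⟩
    have : deriv u = u' := by ext x; exact (hu x).deriv
    rwa [this]
  have huac : AbsolutelyContinuousOnInterval u a b := huc.contDiffOn.absolutelyContinuousOnInterval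
  have key := hfac.integral_mul_deriv_eq_deriv_mul huac
  have e1 : ∫ x in a..b, f x * deriv u x = ∫ x in a..b, f x * u' x := by
    congr 1; ext x; rw [(hu x).deriv]
  have e2 : ∫ x in a..b, deriv f x * u x = ∫ x in a..b, f' x * u x := by
    apply intervalIntegral.integral_congr_ae
    filter_upwards [(h a b).1.ae_hasDerivAt_integral] with x hx hx'
    have h3 := hx (Set.uIoc_subset_uIcc hx') a (by simp)
    have h4 : HasDerivAt f (f' x) x := by
      have e : f = fun x => f a + ∫ v in a..x, f' v := by
        funext x
        rw [← (h a x).2]; ring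
      rw [e]
      exact h3.const_add (f a)
    rw [h4.deriv]
  rw [e1, e2] at key
  linarith

lemma IsPrim.intMul {f f' u : ℝ → ℝ} (h : IsPrim f f') (hu : Continuous u) (a b : ℝ) :
    IntervalIntegrable (fun t => f' t * u t) volume a b :=
  (h a b).1.mul_continuousOn hu.continuousOn

/-- Hardy-type lemma on a half line. -/
lemma IsPrim.hardy {f f' u u' : ℝ → ℝ} (h : IsPrim f f') (hu : ∀ x, HasDerivAt u (u' x) x)
    (hu' : Continuous u') (a : ℝ) (hpos : ∀ x, a ≤ x → 0 ≤ u x) (hneg : ∀ x, a ≤ x → u' x ≤ 0)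
    (hintg : IntegrableOn u' (Set.Ioi a))
    (hf' : IntegrableOn (fun x => f' x * u x) (Set.Ioi a)) :
    IntegrableOn (fun x => f x * u' x) (Set.Ioi a) := by
  set F : ℝ → ℝ := fun x => ∫ t in a..x, |f' t| with hF
  have hFp : IsPrim F (fun t => |f' t|) := IsPrim.of_locInt (fun p q => (h p q).1.abs) a
  have hFn : ∀ x, a ≤ x → 0 ≤ F x := fun x hx =>
    intervalIntegral.integral_nonneg hx fun t _ => abs_nonneg _
  have huc : Continuous u := continuous_iff_continuousAt.2 fun x => (hu x).continuousAt
  have h1 : IntegrableOn (fun x => F x * u' x) (Set.Ioi a) := by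
    refine integrableOn_Ioi_of_intervalIntegral_norm_bounded (l := atTop) (b := fun x : ℝ => x)
      (∫ x in Set.Ioi a, |f' x * u x|) a (fun i => ?_) tendsto_id ?_
    · exact ((hFp.cont.mul hu').integrableOn_Icc).mono_set Set.Ioc_subset_Icc_self
    · filter_upwards [eventually_ge_atTop a] with R hR
      have e1 : ∫ x in a..R, ‖F x * u' x‖ = - ∫ x in a..R, F x * u' x := by
        rw [← intervalIntegral.integral_neg]
        apply intervalIntegral.integral_congr
        intro x hx
        rw [Set.uIcc_of_le hR] at hx
        simp only [Real.norm_eq_abs]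
        rw [abs_of_nonpos (mul_nonpos_of_nonneg_of_nonpos (hFn x hx.1) (hneg x hx.1))]
      have e2 := hFp.ibp hu hu' a R
      have e3 : F a = 0 := by simp [hF]
      have e4 : ∫ t in a..R, |f' t| * u t ≤ ∫ x in Set.Ioi a, |f' x * u x| := by
        have : ∫ t in a..R, |f' t| * u t = ∫ t in a..R, |f' t * u t| := by
          apply intervalIntegral.integral_congr
          intro x hx
          rw [Set.uIcc_of_le hR] at hx
          simp only [abs_mul, abs_of_nonneg (hpos x hx.1)]
        rw [this, intervalIntegral.integral_of_le hR]
        exact setIntegral_mono_set hf'.abs (Eventually.of_forall fun x => abs_nonneg _)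
          (Set.Ioc_subset_Ioi_self).eventuallyLE
      have e5 : 0 ≤ F R * u R := mul_nonneg (hFn R hR) (hpos R hR)
      rw [e1]
      rw [e3] at e2
      linarith
  have h2 : IntegrableOn (fun x => |f a| * |u' x| + |F x * u' x|) (Set.Ioi a) :=
    (hintg.abs.const_mul _).add h1.abs
  refine h2.mono' ((h.cont.mul hu').aestronglyMeasurable) ?_
  filter_upwards [ae_restrict_mem measurableSet_Ioi] with x hx
  have hx : a ≤ x := le_of_lt hx
  have : |f x| ≤ |f a| + |F x| := by
    have h3 : |f x - f a| ≤ F x := by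
      rw [(h a x).2]
      exact intervalIntegral.abs_integral_le_integral_abs hx
    have h4 := abs_add_le (f a) (f x - f a)
    rw [add_sub_cancel] at h4
    linarith [le_abs_self (F x)]
  rw [Real.norm_eq_abs, abs_mul, abs_mul, ← add_mul]
  exact mul_le_mul_of_nonneg_right this (abs_nonneg _)

lemma gam_poly_memLp (p : Polynomial ℝ) (q : ENNReal) (hq : q ≠ ⊤) :
    MemLp (fun x => p.eval x) q gam := by
  have hpow : ∀ k : ℕ, MemLp (fun x : ℝ => x ^ k) q gam := by
    intro k
    by_cases hk : k = 0
    · subst hk; simpa using memLp_const (1:ℝ)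
    have := (memLp_id_gaussianReal' (μ := 0) (v := 1) (q * k)
      (ENNReal.mul_ne_top hq (ENNReal.natCast_ne_top k)))
    have h2 := this.norm_rpow_div (k : ENNReal)
    rw [ENNReal.mul_div_cancel_right (by exact_mod_cast hk) (ENNReal.natCast_ne_top k)] at h2
    refine h2.of_le (by fun_prop) (Eventually.of_forall fun x => ?_)
    simp
  have : (fun x => p.eval x) = fun x => ∑ i ∈ range (p.natDegree + 1), p.coeff i * x ^ i := by
    ext x; exact Polynomial.eval_eq_sum_range x
  rw [this]
  exact memLp_finsetSum _ fun i _ => (hpow i).const_mul _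

lemma gam_poly_integrable (p : Polynomial ℝ) : Integrable (fun x => p.eval x) gam :=
  memLp_one_iff_integrable.1 (gam_poly_memLp p 1 (by simp))

/-- derivative of polynomial times Gaussian density -/
lemma polyphi_hasDeriv (p : Polynomial ℝ) (x : ℝ) :
    HasDerivAt (fun x => p.eval x * phi x)
      ((p.derivative - Polynomial.X * p).eval x * phi x) x := by
  have := (p.hasDerivAt x).mul (phi_hasDeriv x)
  refine this.congr_deriv ?_
  simp
  ring

lemma poly_cont (p : Polynomial ℝ) : Continuous (fun x => p.eval x) := p.continuous

lemma pow_aux (j : ℕ) (x : ℝ) (hx : (j : ℝ) + 1 ≤ x) :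
    2 * ((j : ℝ) * x ^ (j - 1)) ≤ x ^ (j + 1) := by
  cases j with
  | zero => simp at hx ⊢; linarith
  | succ k =>
    push_cast at hx ⊢
    have hk : (0 : ℝ) ≤ k := Nat.cast_nonneg k
    have hx0 : 0 ≤ x := by linarith
    have : x ^ (k + 1 + 1) = x ^ 2 * x ^ k := by ring
    rw [this, ← mul_assoc]
    refine mul_le_mul_of_nonneg_right ?_ (pow_nonneg hx0 k)
    nlinarith

lemma weight_half {f f' : ℝ → ℝ} (h : IsPrim f f') (j : ℕ)
    (hf' : Integrable (fun x => x ^ j * f' x) gam) :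
    IntegrableOn (fun x => x ^ (j + 1) * f x * phi x) (Set.Ioi ((j : ℝ) + 1)) := by
  set a : ℝ := (j : ℝ) + 1 with ha
  have hj : (0 : ℝ) ≤ j := Nat.cast_nonneg j
  set q : Polynomial ℝ := (Polynomial.X ^ j).derivative - Polynomial.X * Polynomial.X ^ j with hq
  have hqe : ∀ x : ℝ, q.eval x = j * x ^ (j - 1) - x ^ (j + 1) := by
    intro x
    simp [hq, Polynomial.derivative_X_pow]
    ring
  have hqi : Integrable (fun x => q.eval x * phi x) volume :=
    (gam_integrable_iff _).1 (gam_poly_integrable q)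
  have hfi := (gam_integrable_iff _).1 hf'
  have key := h.hardy (polyphi_hasDeriv (Polynomial.X ^ j)) (q.continuous.mul phi_cont) a
    (fun x hx => by
      have : 0 ≤ x := by linarith
      have := phi_pos x
      simp only [Polynomial.eval_pow, Polynomial.eval_X]
      positivity)
    (fun x hx => by
      have h1 := pow_aux j x hx
      have h0 : 0 ≤ x := by linarith
      have h2 : 0 ≤ (j : ℝ) * x ^ (j - 1) := by positivity
      have h3 := hqe x
      exact mul_nonpos_of_nonpos_of_nonneg (by rw [h3]; linarith) (phi_pos x).le)
    hqi.integrableOn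
    (by
      refine (hfi.integrableOn).congr_fun (fun x _ => ?_) measurableSet_Ioi
      simp; ring)
  have key2 := key.abs.const_mul 2
  refine key2.mono' ?_ ?_
  · have := h.cont
    have := phi_cont
    exact Continuous.aestronglyMeasurable (by fun_prop)
  · filter_upwards [ae_restrict_mem measurableSet_Ioi] with x hx
    have hx : a ≤ x := le_of_lt hx
    have h1 := pow_aux j x hx
    have h0 : 0 ≤ x := by linarith
    have h2 : 0 ≤ (j : ℝ) * x ^ (j - 1) := by positivity
    have h3 := hqe x
    have h4 : |q.eval x| = x ^ (j + 1) - j * x ^ (j - 1) := by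
      rw [h3, abs_of_nonpos (by linarith)]; ring
    rw [Real.norm_eq_abs, abs_mul, abs_mul, abs_mul, abs_mul, h4,
      abs_of_nonneg (pow_nonneg h0 (j + 1)), abs_of_pos (phi_pos x)]
    have h5 : 0 ≤ |f x| * phi x := mul_nonneg (abs_nonneg _) (phi_pos x).le
    nlinarith

lemma gam_integrable_refl {f : ℝ → ℝ} (h : Integrable f gam) :
    Integrable (fun x => f (-x)) gam := by
  have h1 : gam.map (fun x => -x) = gam := by
    have := gaussianReal_map_neg (μ := 0) (v := 1)
    simpa using this
  rw [← h1] at h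
  exact h.comp_measurable measurable_neg

/-- weighted integrability gains one power under primitives -/
lemma weight_gain {f f' : ℝ → ℝ} (h : IsPrim f f') (j : ℕ)
    (hf' : Integrable (fun x => x ^ j * f' x) gam) :
    Integrable (fun x => x ^ (j + 1) * f x) gam := by
  rw [gam_integrable_iff]
  have hc := h.cont
  have hp := phi_cont
  have hG : Continuous (fun x => x ^ (j + 1) * f x * phi x) := by fun_prop
  have h1 := weight_half h j hf'
  have h2 := weight_half h.refl j (by
    have := gam_integrable_refl hf'
    have h3 := this.const_mul ((-1 : ℝ) ^ (j + 1))
    refine h3.congr (Eventually.of_forall fun x => ?_)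
    simp only
    rw [neg_pow x j, pow_succ]
    have : ((-1 : ℝ) ^ j) * (-1) ^ j = 1 := by rw [← mul_pow]; simp
    linear_combination (-x ^ j * f' (-x)) * this)
  have h2' : IntegrableOn (fun x => x ^ (j + 1) * f x * phi x) (Set.Iio (-((j : ℝ) + 1))) := by
    have h3 : IntegrableOn (fun x => (-x) ^ (j + 1) * f (-x) * phi (-x))
        (Set.Ioi ((j : ℝ) + 1)) := by
      have h4 : IntegrableOn (fun x => (-1 : ℝ) ^ (j + 1) * (x ^ (j + 1) * f (-x) * phi x))
          (Set.Ioi ((j : ℝ) + 1)) := h2.const_mul ((-1 : ℝ) ^ (j + 1))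
      refine h4.congr_fun (fun x _ => ?_) measurableSet_Ioi
      have : phi (-x) = phi x := by simp [phi, gaussianPDFReal]
      simp only
      rw [this, neg_pow x (j + 1)]
      ring
    have := (Measure.measurePreserving_neg (volume : Measure ℝ)).integrableOn_comp_preimage
      (Homeomorph.neg ℝ).measurableEmbedding (f := fun x => x ^ (j + 1) * f x * phi x)
      (s := Set.Iio (-((j : ℝ) + 1)))
    rw [← this]
    convert! h3 using 1
    ext x; simp
  have h3 : IntegrableOn (fun x => x ^ (j + 1) * f x * phi x)
      (Set.Icc (-((j : ℝ) + 1)) ((j : ℝ) + 1)) := hG.integrableOn_Icc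
  rw [← integrableOn_univ]
  refine ((h2'.union h3).union h1).mono_set fun x _ => ?_
  by_cases c1 : x < -((j : ℝ) + 1)
  · exact Or.inl (Or.inl c1)
  by_cases c2 : (j : ℝ) + 1 < x
  · exact Or.inr c2
  · exact Or.inl (Or.inr ⟨not_lt.1 c1, not_lt.1 c2⟩)

/-- `f` integrates against polynomials of degree at most `j` -/
def WI (j : ℕ) (f : ℝ → ℝ) : Prop :=
  ∀ p : Polynomial ℝ, p.natDegree ≤ j → Integrable (fun x => p.eval x * f x) gam

lemma WI_of_pow {j : ℕ} {f : ℝ → ℝ}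
    (h : ∀ i ≤ j, Integrable (fun x => x ^ i * f x) gam) : WI j f := by
  intro p hp
  have : (fun x => p.eval x * f x) =
      fun x => ∑ i ∈ range (p.natDegree + 1), p.coeff i * (x ^ i * f x) := by
    ext x; rw [Polynomial.eval_eq_sum_range, Finset.sum_mul]
    exact Finset.sum_congr rfl fun i _ => by ring
  rw [this]
  refine integrable_finsetSum _ fun i hi => (h i ?_).const_mul _
  have := Finset.mem_range.1 hi
  omega

lemma WI.pow {j : ℕ} {f : ℝ → ℝ} (h : WI j f) {i : ℕ} (hi : i ≤ j) :
    Integrable (fun x => x ^ i * f x) gam := by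
  have := h (Polynomial.X ^ i) (by simpa using hi)
  simpa using this

lemma WI_zero {f : ℝ → ℝ} (h : Integrable f gam) : WI 0 f :=
  WI_of_pow fun i hi => by
    obtain rfl : i = 0 := by omega
    simpa using h

lemma WI_of_memLp {f : ℝ → ℝ} (h : MemLp f 2 gam) (j : ℕ) : WI j f := fun p _ =>
  (gam_poly_memLp p 2 (by simp)).integrable_mul h

lemma WI.prim {f f' : ℝ → ℝ} (h : IsPrim f f') {j : ℕ} (hw : WI j f') : WI (j + 1) f := by
  have hs : ∀ i ≤ j, Integrable (fun x => x ^ (i + 1) * f x) gam := fun i hi =>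
    weight_gain h i (hw.pow hi)
  refine WI_of_pow fun i hi => ?_
  cases i with
  | succ i => exact hs i (by omega)
  | zero =>
    obtain ⟨M, hM⟩ := isCompact_Icc.exists_bound_of_continuousOn
      (h.cont.continuousOn (s := Set.Icc (-1 : ℝ) 1))
    have := (integrable_const |M|).add ((hs 0 (by omega)).abs)
    refine this.mono' (h.cont.aestronglyMeasurable.congr
      (Eventually.of_forall fun x => by simp)) (Eventually.of_forall fun x => ?_)
    simp only [pow_zero, one_mul, zero_add, pow_one, Real.norm_eq_abs, Pi.add_apply, abs_mul]
    by_cases hx : |x| ≤ 1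
    · have h1 := hM x (abs_le.1 hx)
      rw [Real.norm_eq_abs] at h1
      have : 0 ≤ |x| * |f x| := by positivity
      linarith [le_abs_self M]
    · have : |f x| ≤ |x| * |f x| := le_mul_of_one_le_left (abs_nonneg _) (not_le.1 hx).le
      linarith [abs_nonneg M]

/-- Stein's identity -/
lemma stein {f f' : ℝ → ℝ} (h : IsPrim f f') {j : ℕ} (hw : WI j f') (p : Polynomial ℝ)
    (hp : p.natDegree ≤ j) :
    ∫ x, p.eval x * f' x ∂gam =
      ∫ x, (Polynomial.X * p - p.derivative).eval x * f x ∂gam := by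
  set q := Polynomial.X * p - p.derivative with hq
  have hw1 := hw.prim h
  have hqd : q.natDegree ≤ j + 1 := by
    refine (Polynomial.natDegree_sub_le _ _).trans (max_le ?_ ?_)
    · refine Polynomial.natDegree_mul_le.trans ?_
      simp; omega
    · exact (Polynomial.natDegree_derivative_le p).trans (by omega)
  have i1 := (gam_integrable_iff _).1 (hw p hp)
  have i2 := (gam_integrable_iff _).1 (hw1 q hqd)
  have i3 := (gam_integrable_iff _).1 (hw1 p (by omega))
  rw [gam_integral, gam_integral]
  have hder := polyphi_hasDeriv p
  have hcont : Continuous fun x => (p.derivative - Polynomial.X * p).eval x * phi x :=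
    (Polynomial.continuous _).mul phi_cont
  set D : ℝ → ℝ := fun x => f x * (p.eval x * phi x) with hD
  have i3' : Integrable D := i3.congr (Eventually.of_forall fun x => by simp only [hD]; ring)
  set E : ℝ → ℝ := fun x => p.eval x * f' x * phi x - q.eval x * f x * phi x with hE
  have iE : Integrable E := i1.sub i2
  have hintg : ∀ a b, ∫ t in a..b, E t = D b - D a := by
    intro a b
    have := h.ibp hder hcont a b
    have e1 : ∫ t in a..b, f' t * (p.eval t * phi t) = ∫ t in a..b, p.eval t * f' t * phi t := by
      congr 1; ext t; ring
    have e2 : ∫ t in a..b, f t * ((p.derivative - Polynomial.X * p).eval t * phi t) =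
        - ∫ t in a..b, q.eval t * f t * phi t := by
      rw [← intervalIntegral.integral_neg]
      congr 1; ext t; simp [hq]; ring
    rw [e1, e2] at this
    simp only [hE]
    rw [intervalIntegral.integral_sub i1.intervalIntegrable i2.intervalIntegrable]
    simp only [hD]
    linarith
  have htop : Tendsto D atTop (nhds 0) := by
    have t1 : Tendsto (fun x => D 0 + ∫ t in (0:ℝ)..x, E t) atTop
        (nhds (D 0 + ∫ t in Set.Ioi 0, E t)) :=
      tendsto_const_nhds.add
        (intervalIntegral_tendsto_integral_Ioi 0 iE.integrableOn tendsto_id)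
    have t2 : Tendsto D atTop (nhds (D 0 + ∫ t in Set.Ioi 0, E t)) := by
      refine t1.congr fun x => ?_
      rw [hintg]; ring
    have : D 0 + ∫ t in Set.Ioi 0, E t = 0 := by
      refine IntegrableAtFilter.eq_zero_of_tendsto (μ := volume)
        ⟨Set.univ, univ_mem, i3'.integrableOn⟩ ?_ t2
      intro s hs
      rcases mem_atTop_sets.1 hs with ⟨b, hb⟩
      rw [← top_le_iff, ← Real.volume_Ici (a := b)]
      exact measure_mono hb
    rwa [this] at t2
  have hbot : Tendsto D atBot (nhds 0) := by
    have t1 : Tendsto (fun x => D 0 - ∫ t in x..(0:ℝ), E t) atBot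
        (nhds (D 0 - ∫ t in Set.Iic 0, E t)) :=
      tendsto_const_nhds.sub
        (intervalIntegral_tendsto_integral_Iic 0 iE.integrableOn tendsto_id)
    have t2 : Tendsto D atBot (nhds (D 0 - ∫ t in Set.Iic 0, E t)) := by
      refine t1.congr fun x => ?_
      rw [hintg]; ring
    have : D 0 - ∫ t in Set.Iic 0, E t = 0 := by
      refine IntegrableAtFilter.eq_zero_of_tendsto (μ := volume)
        ⟨Set.univ, univ_mem, i3'.integrableOn⟩ ?_ t2
      intro s hs
      rcases mem_atBot_sets.1 hs with ⟨b, hb⟩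
      rw [← top_le_iff, ← Real.volume_Iic (a := b)]
      exact measure_mono hb
    rwa [this] at t2
  have t3 : Tendsto (fun R : ℝ => ∫ t in (-R)..R, E t) atTop (nhds (∫ t, E t)) :=
    intervalIntegral_tendsto_integral iE tendsto_neg_atTop_atBot tendsto_id
  have t4 : Tendsto (fun R : ℝ => ∫ t in (-R)..R, E t) atTop (nhds (0 - 0)) := by
    refine (htop.sub (hbot.comp tendsto_neg_atTop_atBot)).congr fun R => ?_
    rw [hintg]; rfl
  have := tendsto_nhds_unique t3 t4
  simp only [hE] at this
  rw [integral_sub i1 i2] at this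
  linarith

/-- L2 membership propagates to primitives -/
lemma memLp_prim {f f' : ℝ → ℝ} (h : IsPrim f f') (hf' : MemLp f' 2 gam) : MemLp f 2 gam := by
  have hsq : Integrable (fun x => f' x ^ 2) gam := hf'.integrable_sq
  have hsqv := (gam_integrable_iff _).1 hsq
  have hloc : ∀ a b, IntervalIntegrable (fun x => f' x ^ 2) volume a b := by
    intro a b
    have h1 := (hsqv.intervalIntegrable (a := a) (b := b)).mul_continuousOn
      (g := fun x => (phi x)⁻¹) (phi_cont.inv₀ fun x => (phi_pos x).ne').continuousOn
    refine h1.congr (fun x _ => ?_)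
    rw [mul_assoc, mul_inv_cancel₀ (phi_pos x).ne', mul_one]
  set F : ℝ → ℝ := fun x => ∫ t in (0:ℝ)..x, f' t ^ 2 with hF
  have hFp : IsPrim F (fun x => f' x ^ 2) := IsPrim.of_locInt hloc 0
  have hxF := weight_gain hFp 0 (by simpa using hsq)
  have hbd : ∀ x, (f x - f 0) ^ 2 ≤ x * F x := by
    intro x
    rcases eq_or_ne x 0 with rfl | hx
    · simp
    have hD := (h 0 x).2
    set c := (f x - f 0) / x with hc
    have e : ∫ t in (0:ℝ)..x, (f' t - c) ^ 2 = F x - 2 * c * (f x - f 0) + c ^ 2 * x := by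
      have : ∀ t, (f' t - c) ^ 2 = f' t ^ 2 - 2 * c * f' t + c ^ 2 := fun t => by ring
      simp only [this]
      rw [intervalIntegral.integral_add ((hloc 0 x).sub ((h.intInt 0 x).const_mul _))
        intervalIntegrable_const,
        intervalIntegral.integral_sub (hloc 0 x) ((h.intInt 0 x).const_mul _),
        intervalIntegral.integral_const_mul, ← hD, intervalIntegral.integral_const]
      simp [hF]
      ring
    have e2 : x * (F x - 2 * c * (f x - f 0) + c ^ 2 * x) = x * F x - (f x - f 0) ^ 2 := by
      rw [hc]; field_simp; ring
    have e3 : 0 ≤ x * ∫ t in (0:ℝ)..x, (f' t - c) ^ 2 := by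
      rcases lt_or_gt_of_ne hx with hx | hx
      · rw [intervalIntegral.integral_symm]
        have := intervalIntegral.integral_nonneg hx.le
          (fun t _ => sq_nonneg (f' t - c)) (μ := volume)
        nlinarith
      · have := intervalIntegral.integral_nonneg hx.le
          (fun t _ => sq_nonneg (f' t - c)) (μ := volume)
        positivity
    rw [e, e2] at e3
    linarith
  rw [memLp_two_iff_integrable_sq h.cont.aestronglyMeasurable]
  have := (integrable_const (2 * f 0 ^ 2) (μ := gam)).add (hxF.const_mul 2)
  refine this.mono' ((h.cont.pow 2).aestronglyMeasurable) (Eventually.of_forall fun x => ?_)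
  have h1 := hbd x
  simp only [Real.norm_eq_abs, abs_of_nonneg (sq_nonneg (f x)), Pi.add_apply, zero_add, pow_one]
  nlinarith [sq_nonneg (f x - 2 * f 0)]

/-- real Hermite polynomials -/
def He (k : ℕ) : Polynomial ℝ := (Polynomial.hermite k).map (Int.castRingHom ℝ)

lemma He_zero : He 0 = 1 := by simp [He]

lemma He_succ (k : ℕ) : He (k + 1) = Polynomial.X * He k - (He k).derivative := by
  simp [He, Polynomial.hermite_succ, Polynomial.derivative_map]

lemma He_monic (k : ℕ) : (He k).Monic := (Polynomial.hermite_monic k).map _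

lemma He_natDegree (k : ℕ) : (He k).natDegree = k := by
  rw [He, (Polynomial.hermite_monic k).natDegree_map, Polynomial.natDegree_hermite]

/-- Hermite coefficients -/
def cf (k : ℕ) (f : ℝ → ℝ) : ℝ := ∫ x, (He k).eval x * f x ∂gam

lemma cf_chain (gd : ℕ → ℝ → ℝ) (i : ℕ) : ∀ j : ℕ,
    (∀ k < i, IsPrim (gd k) (gd (k + 1))) → WI j (gd i) → cf j (gd i) = cf (i + j) (gd 0) := by
  induction i with
  | zero => intro j _ _; simp
  | succ i ih =>
    intro j hp hw
    have h1 := hp i (Nat.lt_succ_self i)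
    have h2 := stein h1 hw (He j) (He_natDegree j).le
    have h3 := ih (j + 1) (fun k hk => hp k (by omega)) (hw.prim h1)
    rw [cf, h2, ← He_succ]
    rw [cf] at h3
    rw [h3]
    congr 1
    ring

lemma cf_poly (p : Polynomial ℝ) (k : ℕ) :
    cf k (fun x => p.eval x) = ∫ x, (Polynomial.derivative^[k] p).eval x ∂gam := by
  have := cf_chain (fun i x => (Polynomial.derivative^[i] p).eval x) k 0 (fun i _ => by
    refine IsPrim.of_hasDeriv (fun x => ?_) (Polynomial.continuous _)
    rw [Function.iterate_succ_apply']
    exact Polynomial.hasDerivAt _ x) (WI_zero (gam_poly_integrable _))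
  simp only [add_zero, Function.iterate_zero, id] at this
  rw [← this, cf, He_zero]
  simp

lemma cf_poly_lt (p : Polynomial ℝ) (k : ℕ) (h : p.natDegree < k) :
    cf k (fun x => p.eval x) = 0 := by
  rw [cf_poly, Polynomial.iterate_derivative_eq_zero h]
  simp

lemma cf_He_self (k : ℕ) : cf k (fun x => (He k).eval x) = (k.factorial : ℝ) := by
  rw [cf_poly]
  have hd : (Polynomial.derivative^[k] (He k)) = Polynomial.C (k.factorial : ℝ) := by
    have h0 : (Polynomial.derivative^[k] (He k)).natDegree ≤ 0 := by
      refine (Polynomial.natDegree_iterate_derivative _ _).trans ?_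
      rw [He_natDegree]; omega
    rw [Polynomial.eq_C_of_natDegree_le_zero h0, Polynomial.coeff_iterate_derivative]
    have : (He k).coeff (0 + k) = 1 := by
      have := (He_monic k).coeff_natDegree
      rw [He_natDegree] at this
      simpa using this
    rw [this]
    simp [Nat.descFactorial_self]
  rw [hd]; simp

lemma He_orth {j k : ℕ} (h : j ≠ k) : ∫ x, (He j).eval x * (He k).eval x ∂gam = 0 := by
  rcases lt_or_gt_of_ne h with h | h
  · have := cf_poly_lt (He j) k (by rwa [He_natDegree])
    rw [cf] at this
    rw [← this]; congr 1; ext x; ring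
  · exact cf_poly_lt (He k) j (by rwa [He_natDegree])

lemma poly_orth {f : ℝ → ℝ} (hf : MemLp f 2 gam) (h : ∀ k, cf k f = 0) :
    ∀ (d : ℕ) (p : Polynomial ℝ), p.natDegree ≤ d → ∫ x, p.eval x * f x ∂gam = 0 := by
  have aux : ∀ p : Polynomial ℝ, Integrable (fun x => p.eval x * f x) gam := fun p =>
    WI_of_memLp hf _ p le_rfl
  have red : ∀ (c : ℝ) (d : ℕ) (p : Polynomial ℝ),
      ∫ x, (p - Polynomial.C c * He d).eval x * f x ∂gam = ∫ x, p.eval x * f x ∂gam := by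
    intro c d p
    have h0 := h d
    rw [cf] at h0
    have : ∀ x, (p - Polynomial.C c * He d).eval x * f x =
        p.eval x * f x - c * ((He d).eval x * f x) := fun x => by simp; ring
    simp only [this]
    rw [integral_sub (aux p) ((aux (He d)).const_mul c), integral_const_mul, h0]
    simp
  intro d
  induction d with
  | zero =>
    intro p hp
    rw [← red (p.coeff 0) 0 p, He_zero, Polynomial.eq_C_of_natDegree_le_zero hp]
    simp
  | succ d ih =>
    intro p hp
    rw [← red (p.coeff (d + 1)) (d + 1) p]
    apply ih
    rw [Polynomial.natDegree_le_iff_coeff_eq_zero]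
    intro N hN
    rcases eq_or_lt_of_le (Nat.succ_le_of_lt hN) with hN | hN
    · subst hN
      have := (He_monic (d + 1)).coeff_natDegree
      rw [He_natDegree] at this
      simp [this]
    · rw [Polynomial.coeff_sub, Polynomial.coeff_C_mul,
        Polynomial.coeff_eq_zero_of_natDegree_lt (p := p) (by omega),
        Polynomial.coeff_eq_zero_of_natDegree_lt (p := He (d + 1)) (by rw [He_natDegree]; omega)]
      simp

lemma exp_abs_memLp (t : ℝ) : MemLp (fun x : ℝ => Real.exp (|t| * |x|)) 2 gam := by
  rw [memLp_two_iff_integrable_sq (by fun_prop)]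
  have := integrable_exp_mul_abs (X := fun x : ℝ => x) (μ := gam) (t := 2 * |t|)
    (integrable_exp_mul_gaussianReal _) (integrable_exp_mul_gaussianReal _)
  refine this.congr (Eventually.of_forall fun x => ?_)
  simp only
  rw [← Real.exp_nat_mul]
  congr 1; push_cast; ring

lemma gam_fourier_zero {f : ℝ → ℝ} (hf : MemLp f 2 gam) (h : ∀ k, cf k f = 0) (t : ℝ) :
    ∫ x, Complex.exp (t * x * Complex.I) * (f x : ℂ) ∂gam = 0 := by
  have hm := hf.aestronglyMeasurable
  have key := hasSum_integral_of_dominated_convergence (μ := gam)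
    (F := fun (k : ℕ) (x : ℝ) => ((t * x * Complex.I) ^ k / (k.factorial : ℂ)) * (f x : ℂ))
    (f := fun x => Complex.exp (t * x * Complex.I) * (f x : ℂ))
    (bound := fun k x => ((|t| * |x|) ^ k / (k.factorial : ℝ)) * |f x|)
    (fun k => by
      refine AEStronglyMeasurable.mul ?_ (Complex.continuous_ofReal.comp_aestronglyMeasurable hm)
      exact Continuous.aestronglyMeasurable (by fun_prop))
    (fun k => Eventually.of_forall fun x => by
      simp [mul_pow])
    (Eventually.of_forall fun x => (Real.summable_pow_div_factorial _).mul_right _)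
    (by
      have : (fun x => ∑' k : ℕ, ((|t| * |x|) ^ k / (k.factorial : ℝ)) * |f x|) =
          fun x => Real.exp (|t| * |x|) * |f x| := by
        ext x
        rw [tsum_mul_right, Real.exp_eq_exp_ℝ, NormedSpace.exp_eq_tsum_div]
      rw [this]
      exact (exp_abs_memLp t).integrable_mul hf.norm)
    (Eventually.of_forall fun x => by
      refine HasSum.mul_right _ ?_
      rw [Complex.exp_eq_exp_ℂ]
      exact NormedSpace.expSeries_div_hasSum_exp _)
  have hz : ∀ k : ℕ, ∫ x : ℝ, ((t * x * Complex.I) ^ k / (k.factorial : ℂ)) * (f x : ℂ) ∂gam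
      = 0 := by
    intro k
    have h0 := poly_orth hf h k (Polynomial.X ^ k) (by simp)
    simp only [Polynomial.eval_pow, Polynomial.eval_X] at h0
    have : ∀ x : ℝ, ((t * x * Complex.I) ^ k / (k.factorial : ℂ)) * (f x : ℂ) =
        ((t * Complex.I) ^ k / (k.factorial : ℂ)) * ((x ^ k * f x : ℝ) : ℂ) := fun x => by
      push_cast; rw [mul_pow, mul_pow, mul_pow]; ring
    simp only [this]
    rw [integral_const_mul, integral_complex_ofReal, h0]; simp
  simp only [hz] at key
  exact key.unique hasSum_zero

lemma charFun_dens {f : ℝ → ℝ} (hf : Measurable f) (t : ℝ) :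
    charFun (gam.withDensity fun x => ENNReal.ofReal (f x)) t =
      ∫ x, Complex.exp (t * x * Complex.I) * ((max (f x) 0 : ℝ) : ℂ) ∂gam := by
  rw [charFun_apply_real, integral_withDensity_eq_integral_toReal_smul (by fun_prop)
    (Eventually.of_forall fun x => ENNReal.ofReal_lt_top)]
  congr 1; ext x
  rw [ENNReal.toReal_ofReal', Complex.real_smul, mul_comm]

lemma complete_meas {f : ℝ → ℝ} (hm : Measurable f) (hf : MemLp f 2 gam)
    (h : ∀ k, cf k f = 0) : f =ᵐ[gam] 0 := by
  have hi : Integrable f gam := hf.integrable (by norm_num)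
  have hin : Integrable (fun x => -f x) gam := hi.neg
  have f1 : IsFiniteMeasure (gam.withDensity fun x => ENNReal.ofReal (f x)) :=
    isFiniteMeasure_withDensity_ofReal hi.2
  have f2 : IsFiniteMeasure (gam.withDensity fun x => ENNReal.ofReal (-f x)) :=
    isFiniteMeasure_withDensity_ofReal hin.2
  have heq : (gam.withDensity fun x => ENNReal.ofReal (f x)) =
      gam.withDensity fun x => ENNReal.ofReal (-f x) := by
    refine Measure.ext_of_charFun ?_
    ext t
    rw [charFun_dens hm, charFun_dens (f := fun x => -f x) hm.neg, ← sub_eq_zero]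
    have hb : ∀ g : ℝ → ℝ, Integrable g gam →
        Integrable (fun x : ℝ => Complex.exp (t * x * Complex.I) * (g x : ℂ)) gam := by
      intro g hg
      refine hg.norm.mono' ?_ (Eventually.of_forall fun x => ?_)
      · refine AEStronglyMeasurable.mul (Continuous.aestronglyMeasurable (by fun_prop))
          (Complex.continuous_ofReal.comp_aestronglyMeasurable hg.1)
      · rw [norm_mul]
        have : ‖Complex.exp (t * x * Complex.I)‖ = 1 := by
          rw [← Complex.ofReal_mul]; exact Complex.norm_exp_ofReal_mul_I _
        rw [this]; simp
    rw [← integral_sub (hb (fun x => max (f x) 0) (hi.sup (integrable_zero _ _ _)))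
      (hb (fun x => max (-f x) 0) (hin.sup (integrable_zero _ _ _)))]
    rw [← gam_fourier_zero hf h t]
    congr 1; ext x
    rw [← mul_sub, ← Complex.ofReal_sub]
    congr 2
    rcases le_total 0 (f x) with h | h
    · rw [max_eq_left h, max_eq_right (by linarith)]; ring
    · rw [max_eq_right h, max_eq_left (by linarith)]; ring
  rw [withDensity_eq_iff (by fun_prop) (by fun_prop) (by
    exact (hi.lintegral_lt_top).ne)] at heq
  filter_upwards [heq] with x hx
  rcases le_total 0 (f x) with h | h
  · rw [ENNReal.ofReal_of_nonpos (p := -f x) (by linarith), ENNReal.ofReal_eq_zero] at hx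
    exact le_antisymm hx h
  · rw [ENNReal.ofReal_of_nonpos h, eq_comm, ENNReal.ofReal_eq_zero] at hx
    exact le_antisymm h (neg_nonpos.1 hx)

lemma complete_gam {f : ℝ → ℝ} (hf : MemLp f 2 gam) (h : ∀ k, cf k f = 0) : f =ᵐ[gam] 0 := by
  have hm := hf.aestronglyMeasurable
  have hae := hm.ae_eq_mk
  have h1 := complete_meas hm.stronglyMeasurable_mk.measurable (hf.ae_eq hae) (fun k => by
    rw [← h k, cf, cf]
    refine integral_congr_ae ?_
    filter_upwards [hae] with x hx
    rw [hx])
  exact hae.trans h1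

/-- normalized Hermite functions in L2 -/
def hv (k : ℕ) : Lp ℝ 2 gam := (gam_poly_memLp (He k) 2 (by simp)).toLp _

lemma inner_hv {f : ℝ → ℝ} (hf : MemLp f 2 gam) (k : ℕ) :
    inner ℝ (hv k) (hf.toLp f) = cf k f := by
  rw [L2.inner_def, cf]
  refine integral_congr_ae ?_
  filter_upwards [hf.coeFn_toLp, (gam_poly_memLp (He k) 2 (by simp)).coeFn_toLp] with x h1 h2
  rw [hv, h1, h2]
  simp [mul_comm]

lemma inner_hv_hv (j k : ℕ) :
    inner ℝ (hv j) (hv k) = if j = k then (k.factorial : ℝ) else 0 := by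
  rw [hv.eq_1 k, inner_hv]
  split_ifs with h
  · subst h; exact cf_He_self j
  · exact He_orth h

lemma parseval {f : ℝ → ℝ} (hf : MemLp f 2 gam) :
    HasSum (fun k => cf k f ^ 2 / (k.factorial : ℝ)) (∫ x, f x ^ 2 ∂gam) := by
  have hfac : ∀ k : ℕ, (0 : ℝ) < k.factorial := fun k => by exact_mod_cast k.factorial_pos
  set e : ℕ → Lp ℝ 2 gam := fun k => (Real.sqrt k.factorial)⁻¹ • hv k with he
  have hon : Orthonormal ℝ e := by
    rw [orthonormal_iff_ite]
    intro i j
    simp only [he]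
    rw [inner_smul_left, inner_smul_right, inner_hv_hv]
    split_ifs with h
    · subst h
      have h1 := Real.mul_self_sqrt (hfac i).le
      have h2 := Real.sqrt_pos.2 (hfac i)
      simp only [conj_trivial]
      field_simp
      nlinarith
    · simp
  have hbot : (Submodule.span ℝ (Set.range e))ᗮ = ⊥ := by
    rw [Submodule.eq_bot_iff]
    intro F hF
    have h1 : ∀ k, inner ℝ (e k) F = 0 := fun k =>
      (Submodule.mem_orthogonal _ _).1 hF _ (Submodule.subset_span ⟨k, rfl⟩)
    have hm : MemLp (F : ℝ → ℝ) 2 gam := Lp.memLp F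
    have h2 : ∀ k, cf k F = 0 := by
      intro k
      rw [← inner_hv hm k, Lp.toLp_coeFn]
      have := h1 k
      simp only [he] at this
      rw [inner_smul_left] at this
      rcases mul_eq_zero.1 this with h | h
      · exfalso
        simp only [conj_trivial, inv_eq_zero] at h
        exact (Real.sqrt_pos.2 (hfac k)).ne' h
      · exact h
    have h3 := complete_gam hm h2
    exact (Lp.eq_zero_iff_ae_eq_zero).2 h3
  set b := HilbertBasis.mkOfOrthogonalEqBot hon hbot with hb
  have hs := b.hasSum_inner_mul_inner (hf.toLp f) (hf.toLp f)
  have hbe : ∀ k, b k = e k := fun k => by rw [hb, HilbertBasis.coe_mkOfOrthogonalEqBot]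
  convert! hs using 1
  · ext k
    rw [hbe, real_inner_comm (e k) (hf.toLp f)]
    simp only [he]
    rw [inner_smul_left, inner_hv]
    have h1 := Real.mul_self_sqrt (hfac k).le
    have h2 := Real.sqrt_pos.2 (hfac k)
    simp only [conj_trivial]
    rw [div_eq_mul_inv, ← h1, mul_inv]
    simp only [h1]
    ring
  · rw [L2.inner_def]
    refine integral_congr_ae ?_
    filter_upwards [hf.coeFn_toLp] with x h1
    rw [h1]; simp [sq]

lemma fall_zero (x : ℝ) : fall x 0 = 1 := by simp [fall]

lemma fall_succ (x : ℝ) (k : ℕ) : fall x (k + 1) = fall x k * (x - k) := by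
  simp [fall, Finset.prod_range_succ]

lemma fall_succ' (x : ℝ) (k : ℕ) : fall x (k + 1) = x * fall (x - 1) k := by
  rw [fall, Finset.prod_range_succ', mul_comm]
  simp only [Nat.cast_zero, sub_zero, fall]
  congr 1
  refine Finset.prod_congr rfl fun j _ => ?_
  push_cast; ring

lemma fall_add (x : ℝ) (i j : ℕ) : fall x (i + j) = fall x i * fall (x - i) j := by
  induction j with
  | zero => simp [fall_zero]
  | succ j ih =>
    rw [← add_assoc, fall_succ, ih, fall_succ]
    push_cast; ring

lemma fall_nat (a k : ℕ) : fall (a : ℝ) k = (a.descFactorial k : ℝ) := by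
  induction k with
  | zero => simp [fall_zero]
  | succ k ih =>
    rw [fall_succ, ih, Nat.descFactorial_succ]
    rcases le_or_gt k a with h | h
    · push_cast [Nat.cast_sub h]; ring
    · rw [Nat.descFactorial_of_lt h]; simp

lemma fall_neg (y : ℝ) (n : ℕ) : fall (-y) n = (-1) ^ n * fall (y + n - 1) n := by
  induction n with
  | zero => simp [fall_zero]
  | succ n ih =>
    rw [fall_succ, ih, fall_succ']
    have : y + ((n + 1 : ℕ) : ℝ) - 1 - 1 = y + n - 1 := by push_cast; ring
    rw [this]
    push_cast; ring

lemma fall_vand (n : ℕ) : ∀ M k : ℝ,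
    ∑ i ∈ range (n + 1), (-1 : ℝ) ^ i * (n.choose i : ℝ) * fall k i * fall (M - i) (n - i)
      = fall (M - k) n := by
  induction n with
  | zero => intro M k; simp [fall_zero]
  | succ n ih =>
    intro M k
    have h1 := ih M k
    have h2 := ih (M - 1) (k - 1)
    have e2 : M - 1 - (k - 1) = M - k := by ring
    rw [e2] at h2
    have hA : ∑ i ∈ range (n + 2), (-1 : ℝ) ^ i * (n.choose i : ℝ) * fall k i *
        fall (M - i) (n + 1 - i) = (M - n) * fall (M - k) n := by
      rw [Finset.sum_range_succ, Nat.choose_succ_self]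
      simp only [Nat.cast_zero, mul_zero, zero_mul, add_zero]
      rw [← h1, Finset.mul_sum]
      refine Finset.sum_congr rfl fun i hi => ?_
      have hi : i ≤ n := Nat.lt_succ_iff.1 (Finset.mem_range.1 hi)
      rw [Nat.succ_sub hi, fall_succ, Nat.cast_sub hi]
      ring
    have hB : ∑ i ∈ range (n + 1), (-1 : ℝ) ^ (i + 1) * (n.choose i : ℝ) * fall k (i + 1) *
        fall (M - (i + 1 : ℕ)) (n + 1 - (i + 1)) = - k * fall (M - k) n := by
      rw [← h2, Finset.mul_sum]
      refine Finset.sum_congr rfl fun i hi => ?_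
      rw [fall_succ', Nat.add_sub_add_right]
      have : M - ((i + 1 : ℕ) : ℝ) = M - 1 - i := by push_cast; ring
      rw [this]
      ring
    rw [Finset.sum_range_succ']
    have hC : ∑ i ∈ range (n + 1), (-1 : ℝ) ^ (i + 1) * ((n + 1).choose (i + 1) : ℝ) *
        fall k (i + 1) * fall (M - (i + 1 : ℕ)) (n + 1 - (i + 1)) =
        (∑ i ∈ range (n + 1), (-1 : ℝ) ^ (i + 1) * (n.choose i : ℝ) * fall k (i + 1) *
          fall (M - (i + 1 : ℕ)) (n + 1 - (i + 1))) +
        ∑ i ∈ range (n + 1), (-1 : ℝ) ^ (i + 1) * (n.choose (i + 1) : ℝ) * fall k (i + 1) *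
          fall (M - (i + 1 : ℕ)) (n + 1 - (i + 1)) := by
      rw [← Finset.sum_add_distrib]
      refine Finset.sum_congr rfl fun i _ => ?_
      rw [Nat.choose_succ_succ]; push_cast; ring
    rw [Finset.sum_range_succ'] at hA
    rw [hC, hB, fall_succ]
    simp only [Nat.choose_zero_right] at hA ⊢
    linarith

lemma fall_pos_nat (a k : ℕ) (h : k ≤ a) : 0 < fall (a : ℝ) k := by
  rw [fall_nat]; exact_mod_cast Nat.descFactorial_pos.2 h

/-- the key coefficient identity -/
lemma coef_id (m n k : ℕ) (hn : 1 ≤ n) :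
    (-1 : ℝ) ^ n * fall ((m : ℝ) + n) n *
      ((∑ i ∈ range (n + 1), (-1 : ℝ) ^ i * ((n.choose i : ℝ) / fall ((m : ℝ) + n) i) * fall k i)
        - fall m k / fall ((m : ℝ) + n) k) = ((k - m - 1).descFactorial n : ℝ) := by
  have hpos : ∀ i ≤ m + n, 0 < fall ((m : ℝ) + n) i := by
    intro i hi
    have := fall_pos_nat (m + n) i hi
    push_cast at this; exact this
  have h1 : fall ((m : ℝ) + n) n * (∑ i ∈ range (n + 1),
      (-1 : ℝ) ^ i * ((n.choose i : ℝ) / fall ((m : ℝ) + n) i) * fall k i) =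
      fall ((m : ℝ) + n - k) n := by
    rw [← fall_vand, Finset.mul_sum]
    refine Finset.sum_congr rfl fun i hi => ?_
    have hi : i ≤ n := Nat.lt_succ_iff.1 (Finset.mem_range.1 hi)
    have h2 := fall_add ((m : ℝ) + n) i (n - i)
    rw [Nat.add_sub_cancel' hi] at h2
    have h3 := hpos i (by omega)
    rw [h2]
    field_simp
  rw [mul_assoc, mul_sub, h1]
  rcases le_or_gt k m with hk | hk
  · have e1 : fall ((m : ℝ) + n) k * fall ((m : ℝ) + n - k) n
        = fall ((m : ℝ) + n) n * fall m k := by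
      rw [← fall_add, add_comm k n, fall_add]; congr 2; ring
    have h3 := hpos k (by omega)
    have e2 : fall ((m : ℝ) + n) n * (fall m k / fall ((m : ℝ) + n) k) =
        fall ((m : ℝ) + n - k) n := by
      rw [← mul_div_assoc, ← e1]; field_simp
    rw [e2, Nat.descFactorial_of_lt (by omega)]
    simp
  · have e0 : fall (m : ℝ) k = 0 := by
      rw [fall_nat, Nat.descFactorial_of_lt hk]; simp
    rw [e0]
    simp only [zero_div, mul_zero, sub_zero]
    rcases le_or_gt k (m + n) with hk2 | hk2
    · have : (m : ℝ) + n - k = ((m + n - k : ℕ) : ℝ) := by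
        rw [Nat.cast_sub hk2]; push_cast; ring
      rw [this, fall_nat, Nat.descFactorial_of_lt (by omega), Nat.descFactorial_of_lt (by omega)]
      simp
    · have : (m : ℝ) + n - k = -((k : ℝ) - m - n) := by ring
      rw [this, fall_neg, ← fall_nat]
      have e : ((k - m - 1 : ℕ) : ℝ) = (k : ℝ) - m - n + n - 1 := by
        rw [Nat.cast_sub (by omega), Nat.cast_sub (by omega)]; push_cast; ring
      rw [e, ← mul_assoc, ← mul_pow]
      simp

lemma desc_mono {a b : ℕ} (h : a ≤ b) (n : ℕ) : a.descFactorial n ≤ b.descFactorial n :=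
  Nat.descFactorial_le n h

lemma desc_strict {a b : ℕ} (h : a < b) (n : ℕ) (hn : 1 ≤ n) (hb : n ≤ b) :
    a.descFactorial n < b.descFactorial n := by
  obtain ⟨k, rfl⟩ : ∃ k, n = k + 1 := ⟨n - 1, by omega⟩
  obtain ⟨c, rfl⟩ : ∃ c, b = c + 1 := ⟨b - 1, by omega⟩
  rw [Nat.succ_descFactorial_succ]
  have hc : 0 < c.descFactorial k := Nat.descFactorial_pos.2 (by omega)
  cases a with
  | zero => simp; omega
  | succ a =>
    rw [Nat.succ_descFactorial_succ]
    have := desc_mono (a := a) (b := c) (by omega) k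
    calc (a + 1) * a.descFactorial k ≤ (a + 1) * c.descFactorial k := Nat.mul_le_mul_left _ this
      _ < (c + 1) * c.descFactorial k := Nat.mul_lt_mul_of_pos_right (by omega) hc

/-- squared normalized Hermite coefficient -/
def bc (g : ℝ → ℝ) (k : ℕ) : ℝ := cf k g ^ 2 / (k.factorial : ℝ)

lemma bc_nonneg (g : ℝ → ℝ) (k : ℕ) : 0 ≤ bc g k := by unfold bc; positivity

section std

variable {gd : ℕ → ℝ → ℝ} {n ℓ : ℕ}

lemma std_memLp (hp : ∀ k < n, IsPrim (gd k) (gd (k + 1))) (h2 : MemLp (gd n) 2 gam) :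
    ∀ j i, i + j = n → MemLp (gd i) 2 gam := by
  intro j
  induction j with
  | zero => intro i hi; simp at hi; subst hi; exact h2
  | succ j ih => intro i hi; exact memLp_prim (hp i (by omega)) (ih (i + 1) (by omega))

lemma std_sum (hp : ∀ k < n, IsPrim (gd k) (gd (k + 1))) (h2 : MemLp (gd n) 2 gam)
    (i : ℕ) (hi : i ≤ n) :
    HasSum (fun k : ℕ => fall k i * bc (gd 0) k) (∫ x, gd i x ^ 2 ∂gam) := by
  have hm := std_memLp hp h2 (n - i) i (by omega)
  have h := parseval hm
  have hc : ∀ j, cf j (gd i) = cf (i + j) (gd 0) := fun j =>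
    cf_chain gd i j (fun k hk => hp k (by omega)) (WI_of_memLp hm j)
  have h3 := (hasSum_nat_add_iff (f := fun k : ℕ => fall k i * bc (gd 0) k)
    (g := ∫ x, gd i x ^ 2 ∂gam) i).1 (by
      refine h.congr_fun ?_
      intro j
      rw [hc j, add_comm j i, bc, fall_nat]
      have h4 := Nat.factorial_mul_descFactorial (n := i + j) (k := i) (by omega)
      rw [Nat.add_sub_cancel_left] at h4
      have h5 : ((i + j).factorial : ℝ) = j.factorial * (i + j).descFactorial i := by
        exact_mod_cast h4.symm
      have h6 : (0 : ℝ) < j.factorial := by exact_mod_cast j.factorial_pos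
      have h7 : (0 : ℝ) < (i + j).descFactorial i := by
        exact_mod_cast Nat.descFactorial_pos.2 (by omega)
      rw [h5]
      field_simp)
  have h4 : ∑ k ∈ range i, fall (k : ℝ) i * bc (gd 0) k = 0 := by
    refine Finset.sum_eq_zero fun k hk => ?_
    rw [fall_nat, Nat.descFactorial_of_lt (Finset.mem_range.1 hk)]; simp
  rwa [h4, add_zero] at h3

lemma std_mean (hp : ∀ k < ℓ, IsPrim (gd k) (gd (k + 1))) (i : ℕ) (hi : i ≤ ℓ)
    (h1 : Integrable (gd i) gam) :
    (∫ x, gd i x ∂gam) ^ 2 = (i.factorial : ℝ) * bc (gd 0) i := by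
  have := cf_chain gd i 0 (fun k hk => hp k (by omega)) (WI_zero h1)
  rw [add_zero] at this
  rw [bc, ← this, cf, He_zero]
  have h6 : (0 : ℝ) < i.factorial := by exact_mod_cast i.factorial_pos
  simp only [Polynomial.eval_one, one_mul]
  field_simp

lemma std_T (hn : 1 ≤ n) (hnl : n ≤ ℓ) (hp : ∀ k < ℓ, IsPrim (gd k) (gd (k + 1)))
    (h2 : MemLp (gd n) 2 gam) (m : ℕ) (hml : m ≤ ℓ)
    (h1 : ∀ i ≤ m, Integrable (gd i) gam) :
    HasSum (fun k : ℕ => ((k - m - 1).descFactorial n : ℝ) * bc (gd 0) k)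
      ((-1) ^ n * fall ((m : ℝ) + n) n * (variance (gd 0) gam - SnormalBound gam 1 m n gd)) := by
  have hp' : ∀ k < n, IsPrim (gd k) (gd (k + 1)) := fun k hk => hp k (by omega)
  have hm0 := std_memLp hp' h2 n 0 (by omega)
  have hvar : variance (gd 0) gam - SnormalBound gam 1 m n gd =
      (∑ i ∈ range (n + 1), (-1 : ℝ) ^ i * ((n.choose i : ℝ) / fall ((m : ℝ) + n) i) *
        ∫ x, gd i x ^ 2 ∂gam) -
      ∑ i ∈ range (m + 1), (m.choose i : ℝ) / fall ((m : ℝ) + n) i *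
        (∫ x, gd i x ∂gam) ^ 2 := by
    rw [variance_eq_sub hm0, SnormalBound, Finset.sum_range_succ', Finset.sum_range_succ']
    have r : ∀ (N : ℕ) (F : ℕ → ℝ), ∑ i ∈ Icc 1 N, F i = ∑ i ∈ range N, F (i + 1) := by
      intro N F
      rw [Finset.range_eq_Ico, Finset.sum_Ico_add' F 0 N 1]
      rfl
    rw [r, r]
    simp only [one_pow, mul_one, Nat.choose_zero_right, Nat.cast_one, fall_zero, pow_zero,
      div_one, one_mul, Nat.add_sub_cancel, Pi.pow_apply]
    have : ∀ i : ℕ, (-1 : ℝ) ^ (i + 1) * ((n.choose (i + 1) : ℝ) / fall ((m : ℝ) + n) (i + 1)) *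
        (∫ x, gd (i + 1) x ^ 2 ∂gam) = -((-1 : ℝ) ^ i * ((n.choose (i + 1) : ℝ) /
          fall ((m : ℝ) + n) (i + 1)) * ∫ x, gd (i + 1) x ^ 2 ∂gam) := fun i => by ring
    simp only [this, Finset.sum_neg_distrib]
    ring
  have s1 : HasSum (fun k : ℕ => ∑ i ∈ range (n + 1), (-1 : ℝ) ^ i *
      ((n.choose i : ℝ) / fall ((m : ℝ) + n) i) * (fall k i * bc (gd 0) k))
      (∑ i ∈ range (n + 1), (-1 : ℝ) ^ i * ((n.choose i : ℝ) / fall ((m : ℝ) + n) i) *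
        ∫ x, gd i x ^ 2 ∂gam) :=
    hasSum_sum fun i hi => (std_sum hp' h2 i (Nat.lt_succ_iff.1 (Finset.mem_range.1 hi))).mul_left _
  have s2 : HasSum (fun k : ℕ => fall m k / fall ((m : ℝ) + n) k * bc (gd 0) k)
      (∑ i ∈ range (m + 1), (m.choose i : ℝ) / fall ((m : ℝ) + n) i *
        (∫ x, gd i x ∂gam) ^ 2) := by
    have e : ∑ i ∈ range (m + 1), (m.choose i : ℝ) / fall ((m : ℝ) + n) i *
        (∫ x, gd i x ∂gam) ^ 2 =
        ∑ k ∈ range (m + 1), fall m k / fall ((m : ℝ) + n) k * bc (gd 0) k := by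
      refine Finset.sum_congr rfl fun i hi => ?_
      have hi : i ≤ m := Nat.lt_succ_iff.1 (Finset.mem_range.1 hi)
      rw [std_mean hp i (by omega) (h1 i hi), fall_nat m i, Nat.descFactorial_eq_factorial_mul_choose]
      push_cast; ring
    rw [e]
    refine hasSum_sum_of_ne_finset_zero fun k hk => ?_
    have hk : m < k := by simpa using hk
    rw [fall_nat m k, Nat.descFactorial_of_lt hk]; simp
  rw [hvar]
  refine ((s1.sub s2).mul_left ((-1) ^ n * fall ((m : ℝ) + n) n)).congr_fun fun k => ?_
  rw [← coef_id m n k hn]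
  rw [mul_assoc, sub_mul, Finset.sum_mul]
  congr 2
  refine Finset.sum_congr rfl fun i _ => by ring

lemma std_poly (hc : Continuous (gd 0)) (hm0 : MemLp (gd 0) 2 gam) (d : ℕ) :
    (∀ k, d < k → bc (gd 0) k = 0) ↔ IsPolyOn (gd 0) Set.univ d := by
  have hfac : ∀ k : ℕ, (0 : ℝ) < k.factorial := fun k => by exact_mod_cast k.factorial_pos
  constructor
  · intro h
    set p : Polynomial ℝ := ∑ k ∈ range (d + 1),
      Polynomial.C (cf k (gd 0) / (k.factorial : ℝ)) * He k with hp
    have hpd : p.natDegree ≤ d := by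
      refine Polynomial.natDegree_sum_le_of_forall_le _ _ fun k hk => ?_
      refine (Polynomial.natDegree_C_mul_le _ _).trans ?_
      rw [He_natDegree]; exact Nat.lt_succ_iff.1 (Finset.mem_range.1 hk)
    refine ⟨p, hpd, ?_⟩
    have hcf : ∀ j, cf j (fun x => p.eval x) = if j ≤ d then cf j (gd 0) else 0 := by
      intro j
      have e : ∀ x, (He j).eval x * p.eval x = ∑ k ∈ range (d + 1),
          cf k (gd 0) / (k.factorial : ℝ) * ((He j).eval x * (He k).eval x) := by
        intro x
        rw [hp, Polynomial.eval_finsetSum, Finset.mul_sum]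
        refine Finset.sum_congr rfl fun k _ => ?_
        simp; ring
      rw [cf]
      simp only [e]
      rw [integral_finsetSum]
      · simp only [integral_const_mul]
        split_ifs with hj
        · rw [Finset.sum_eq_single j]
          · have := cf_He_self j
            rw [cf] at this
            rw [this, div_mul_cancel₀ _ (hfac j).ne']
          · intro k _ hk
            rw [He_orth (Ne.symm hk), mul_zero]
          · intro hj'; simp at hj'; omega
        · refine Finset.sum_eq_zero fun k hk => ?_
          have := Finset.mem_range.1 hk
          rw [He_orth (by omega), mul_zero]
      · intro k _
        refine Integrable.const_mul ?_ _
        simpa using gam_poly_integrable (He j * He k)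
    have hpm := gam_poly_memLp p 2 (by simp)
    have hz := complete_gam (hm0.sub hpm) (fun k => by
      have e : cf k (gd 0 - fun x => p.eval x) = cf k (gd 0) - cf k (fun x => p.eval x) := by
        rw [cf, cf, cf, ← integral_sub (WI_of_memLp hm0 k _ (He_natDegree k).le)
          (WI_of_memLp hpm k _ (He_natDegree k).le)]
        congr 1; ext x; simp; ring
      rw [e, hcf]
      split_ifs with hk
      · ring
      · have := h k (by omega)
        rw [bc, div_eq_zero_iff] at this
        rcases this with h | h
        · rw [pow_eq_zero_iff (by norm_num)] at h; rw [h]; ring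
        · exact absurd h (hfac k).ne')
    have hz2 := (gaussianReal_absolutelyContinuous' 0 (v := 1) one_ne_zero).ae_eq hz
    have hz3 : gd 0 =ᵐ[volume] fun x => p.eval x := by
      filter_upwards [hz2] with x hx
      simp at hx; linarith
    have := (hc.ae_eq_iff_eq volume p.continuous).1 hz3
    intro x _
    rw [this]
  · rintro ⟨p, hpd, h⟩ k hk
    have e : gd 0 = fun x => p.eval x := by ext x; exact h x trivial
    rw [bc, e, cf_poly_lt p k (by omega)]; simp

theorem std_main (hn : 1 ≤ n) (hnl : n ≤ ℓ) (hp : ∀ k < ℓ, IsPrim (gd k) (gd (k + 1)))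
    (h2 : MemLp (gd n) 2 gam) (m₁ m₂ : ℕ) (hm : m₁ < m₂) (hml : m₂ ≤ ℓ)
    (h1 : ∀ i, n < i → i ≤ m₂ → Integrable (gd i) gam) :
    (fall ((m₂ : ℝ) + n) n / fall ((m₁ : ℝ) + n) n) *
        |variance (gd 0) gam - SnormalBound gam 1 m₂ n gd| ≤
      |variance (gd 0) gam - SnormalBound gam 1 m₁ n gd| ∧
    (|variance (gd 0) gam - SnormalBound gam 1 m₁ n gd| =
        (fall ((m₂ : ℝ) + n) n / fall ((m₁ : ℝ) + n) n) *
          |variance (gd 0) gam - SnormalBound gam 1 m₂ n gd| ↔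
      IsPolyOn (gd 0) Set.univ (n + m₁)) := by
  have hp' : ∀ k < n, IsPrim (gd k) (gd (k + 1)) := fun k hk => hp k (by omega)
  have hm0 := std_memLp hp' h2 n 0 (by omega)
  have hI : ∀ i ≤ m₂, Integrable (gd i) gam := by
    intro i hi
    rcases le_or_gt i n with h | h
    · exact (std_memLp hp' h2 (n - i) i (by omega)).integrable (by norm_num)
    · exact h1 i h hi
  have T1 := std_T hn hnl hp h2 m₁ (by omega) (fun i hi => hI i (by omega))
  have T2 := std_T hn hnl hp h2 m₂ hml hI
  set R1 := variance (gd 0) gam - SnormalBound gam 1 m₁ n gd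
  set R2 := variance (gd 0) gam - SnormalBound gam 1 m₂ n gd
  have hF : ∀ m : ℕ, 0 < fall ((m : ℝ) + n) n := by
    intro m
    have := fall_pos_nat (m + n) n (by omega)
    push_cast at this; exact this
  have hF1 := hF m₁
  have hF2 := hF m₂
  have habs : ∀ (m : ℕ) (R : ℝ), HasSum (fun k : ℕ => ((k - m - 1).descFactorial n : ℝ) *
      bc (gd 0) k) ((-1) ^ n * fall ((m : ℝ) + n) n * R) →
      (-1) ^ n * fall ((m : ℝ) + n) n * R = fall ((m : ℝ) + n) n * |R| := by
    intro m R h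
    have h0 := h.nonneg fun k => mul_nonneg (Nat.cast_nonneg _) (bc_nonneg (gd 0) k)
    rw [← abs_of_nonneg h0, abs_mul, abs_mul, abs_of_pos (hF m)]
    simp
  rw [habs m₁ R1 T1] at T1
  rw [habs m₂ R2 T2] at T2
  have hle : ∀ k : ℕ, ((k - m₂ - 1).descFactorial n : ℝ) * bc (gd 0) k ≤
      ((k - m₁ - 1).descFactorial n : ℝ) * bc (gd 0) k := fun k =>
    mul_le_mul_of_nonneg_right (by exact_mod_cast desc_mono (by omega) n) (bc_nonneg _ k)
  have hT := hasSum_le hle T2 T1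
  have hr : fall ((m₂ : ℝ) + n) n / fall ((m₁ : ℝ) + n) n * |R2| =
      (fall ((m₂ : ℝ) + n) n * |R2|) / fall ((m₁ : ℝ) + n) n := by ring
  rw [hr, div_le_iff₀ hF1, eq_div_iff hF1.ne', mul_comm |R1|]
  refine ⟨hT, ?_⟩
  rw [← std_poly (hp' 0 (by omega)).cont hm0]
  have hd := T1.sub T2
  constructor
  · intro heq k hk
    rw [heq, sub_self] at hd
    have := (hasSum_zero_iff_of_nonneg (fun k => sub_nonneg.2 (hle k))).1 hd
    have := congrFun this k
    simp only [Pi.zero_apply] at this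
    rw [← sub_mul, mul_eq_zero] at this
    rcases this with h | h
    · exfalso
      have h3 : ((k - m₂ - 1).descFactorial n : ℝ) < ((k - m₁ - 1).descFactorial n : ℝ) := by
        exact_mod_cast desc_strict (by omega) n hn (by omega)
      linarith
    · exact h
  · intro h
    have : (fun k : ℕ => ((k - m₁ - 1).descFactorial n : ℝ) * bc (gd 0) k) =
        fun k : ℕ => ((k - m₂ - 1).descFactorial n : ℝ) * bc (gd 0) k := by
      ext k
      rcases le_or_gt k (n + m₁) with hk | hk
      · rw [Nat.descFactorial_of_lt (by omega), Nat.descFactorial_of_lt (by omega)]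
      · rw [h k hk]; simp
    rw [this] at T1
    exact T1.unique T2

end std

/-- the affine standardization map -/
def aff (μ σ : ℝ) (x : ℝ) : ℝ := μ + σ * x

lemma aff_emb (μ σ : ℝ) (hσ : 0 < σ) : MeasurableEmbedding (aff μ σ) := by
  have h1 : Continuous (aff μ σ) := by unfold aff; fun_prop
  refine h1.measurableEmbedding fun x y h => ?_
  unfold aff at h
  have : σ * x = σ * y := by linarith
  exact mul_left_cancel₀ hσ.ne' this

lemma normal_eq_map (μ σ : ℝ) (hσ : 0 < σ) :
    volume.withDensity (fun x => ENNReal.ofReal (normalDensity μ σ x)) = gam.map (aff μ σ) := by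
  have h1 : gam.map (aff μ σ) = gaussianReal μ (NNReal.mk (σ ^ 2) (sq_nonneg σ)) := by
    have h2 : aff μ σ = (fun y => μ + y) ∘ (fun x => σ * x) := rfl
    rw [h2, ← Measure.map_map (by fun_prop) (by fun_prop), gam, gaussianReal_map_const_mul,
      gaussianReal_map_const_add]
    simp
  rw [h1, gaussianReal_of_var_ne_zero]
  · congr 1
    ext x
    rw [gaussianPDF, gaussianPDFReal, normalDensity]
    congr 3
    rw [NNReal.coe_mk, Real.sqrt_mul (x := 2 * Real.pi) (by positivity) (σ ^ 2), Real.sqrt_sq hσ.le]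
  · intro h
    have := congrArg NNReal.toReal h
    simp at this
    exact hσ.ne' this

lemma IsPrim.aff {f f' : ℝ → ℝ} (h : IsPrim f f') (μ σ : ℝ) (hσ : 0 < σ) (k : ℕ) :
    IsPrim (fun x => σ ^ k * f (aff μ σ x)) (fun x => σ ^ (k + 1) * f' (aff μ σ x)) := by
  intro a b
  constructor
  · refine IntervalIntegrable.const_mul ?_ _
    have h1 := (h.intInt (μ + σ * a) (μ + σ * b))
    have h2 := (h1.comp_add_left μ).comp_mul_left (c := σ)
    simpa [_root_.aff, hσ.ne'] using h2
  · rw [intervalIntegral.integral_const_mul]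
    have := intervalIntegral.integral_comp_add_mul f' hσ.ne' μ (a := a) (b := b)
    simp only [_root_.aff]
    rw [this, ← (h _ _).2, smul_eq_mul, ← mul_sub]
    field_simp
    ring

lemma isPoly_aff {f : ℝ → ℝ} {d : ℕ} (h : IsPolyOn f Set.univ d) (a b : ℝ) :
    IsPolyOn (fun x => f (a + b * x)) Set.univ d := by
  obtain ⟨p, hp, h⟩ := h
  refine ⟨p.comp (Polynomial.C b * Polynomial.X + Polynomial.C a), ?_, fun x _ => ?_⟩
  · rw [Polynomial.natDegree_comp]
    have := Polynomial.natDegree_linear_le (a := b) (b := a)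
    nlinarith
  · change f (a + b * x) = _
    rw [h _ (Set.mem_univ _)]
    simp [Polynomial.eval_comp, add_comm]

lemma isPoly_aff_iff (f : ℝ → ℝ) (d : ℕ) (μ σ : ℝ) (hσ : 0 < σ) :
    IsPolyOn (fun x => f (aff μ σ x)) Set.univ d ↔ IsPolyOn f Set.univ d := by
  constructor
  · intro h
    have := isPoly_aff h (-μ / σ) σ⁻¹
    convert this using 2 with x
    unfold aff
    congr 1
    field_simp
    ring
  · intro h
    exact isPoly_aff h μ σ

lemma memH_prim {P : Measure ℝ} {q : ℝ → ℝ} {m n : ℕ} {gd : ℕ → ℝ → ℝ} (hn : 1 ≤ n)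
    (hg : MemH P q Set.univ m n gd) : ∀ k < max m n, IsPrim (gd k) (gd (k + 1)) := by
  obtain ⟨h1, h2, h3, -, -⟩ := hg
  have hl : 1 ≤ max m n := le_max_of_le_right hn
  generalize max m n = ℓ at *
  have hc : ∀ k < ℓ, Continuous (gd k) := by
    intro k hk
    rcases lt_or_ge (k + 1) ℓ with h | h
    · exact continuous_iff_continuousAt.2 fun x => (h1 k h x trivial).continuousAt
    · obtain rfl : k = ℓ - 1 := by omega
      exact continuousOn_univ.1 (h2 hl)
  intro k hk
  rcases lt_or_ge (k + 1) ℓ with h | h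
  · exact IsPrim.of_hasDeriv (fun x => h1 k h x trivial) (hc _ h)
  · obtain rfl : ℓ = k + 1 := by omega
    intro a b
    exact h3 hl a trivial b trivial

lemma snormal_aff (μ σ : ℝ) (hσ : 0 < σ) (m n : ℕ) (gd : ℕ → ℝ → ℝ) :
    SnormalBound (gam.map (aff μ σ)) σ m n gd =
      SnormalBound gam 1 m n (fun k x => σ ^ k * gd k (aff μ σ x)) := by
  unfold SnormalBound
  congr 1
  · refine Finset.sum_congr rfl fun i _ => ?_
    rw [(aff_emb μ σ hσ).integral_map, integral_const_mul]
    ring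
  · refine Finset.sum_congr rfl fun i _ => ?_
    rw [(aff_emb μ σ hσ).integral_map]
    simp only [mul_pow]
    rw [integral_const_mul]
    ring

lemma aesm_prim {gd : ℕ → ℝ → ℝ} {ℓ : ℕ} (hl : 1 ≤ ℓ)
    (hp : ∀ k < ℓ, IsPrim (gd k) (gd (k + 1))) (i : ℕ) (hi : i ≤ ℓ) :
    AEStronglyMeasurable (gd i) gam := by
  rcases lt_or_eq_of_le hi with h | h
  · exact (hp i h).cont.aestronglyMeasurable
  · obtain ⟨j, rfl⟩ : ∃ j, i = j + 1 := ⟨i - 1, by omega⟩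
    exact (hp j (by omega)).locInt.aestronglyMeasurable.mono_ac
      (gaussianReal_absolutelyContinuous 0 one_ne_zero)

/-- **Theorem 3.1 for the normal distribution.** For `0 ≤ m₁ < m₂`,
`|Var g(X) − S_{m₁,n}(g)| ≥ ((m₂+n)_n/(m₁+n)_n) |Var g(X) − S_{m₂,n}(g)|`,
with equality iff `g` is a polynomial of degree at most `n + m₁`. -/
theorem normal_bound_comparison
    (μ σ : ℝ) (hσ : 0 < σ) (P : Measure ℝ)
    (hP : P = volume.withDensity (fun x => ENNReal.ofReal (normalDensity μ σ x)))
    (n : ℕ) (hn : 1 ≤ n) (m₁ m₂ : ℕ) (hm : m₁ < m₂) (gd : ℕ → ℝ → ℝ)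
    (hg : MemH P (fun _ => 1) Set.univ m₂ n gd) :
    (fall ((m₂ : ℝ) + n) n / fall ((m₁ : ℝ) + n) n) *
        |variance (gd 0) P - SnormalBound P σ m₂ n gd| ≤
      |variance (gd 0) P - SnormalBound P σ m₁ n gd| ∧
    (|variance (gd 0) P - SnormalBound P σ m₁ n gd| =
        (fall ((m₂ : ℝ) + n) n / fall ((m₁ : ℝ) + n) n) *
          |variance (gd 0) P - SnormalBound P σ m₂ n gd| ↔
      IsPolyOn (gd 0) Set.univ (n + m₁)) := by
  have hprim := memH_prim hn hg
  rw [normal_eq_map μ σ hσ] at hP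
  subst hP
  have he := aff_emb μ σ hσ
  set G : ℕ → ℝ → ℝ := fun k x => σ ^ k * gd k (aff μ σ x) with hG
  have hGp : ∀ k < max m₂ n, IsPrim (G k) (G (k + 1)) := fun k hk => (hprim k hk).aff μ σ hσ k
  have hl : 1 ≤ max m₂ n := le_max_of_le_right hn
  have hmeas := aesm_prim hl hGp
  obtain ⟨-, -, -, h2, h1⟩ := hg
  have hG2 : MemLp (G n) 2 gam := by
    rw [memLp_two_iff_integrable_sq (hmeas n (le_max_right _ _))]
    rw [he.integrable_map_iff] at h2
    have := h2.const_mul ((σ ^ n) ^ 2)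
    refine this.congr (Eventually.of_forall fun x => ?_)
    simp [hG, mul_pow]
  have hG1 : ∀ i, n < i → i ≤ m₂ → Integrable (G i) gam := by
    intro i hi hi2
    have h3 := h1 i hi hi2
    rw [he.integrable_map_iff] at h3
    have h4 := h3.const_mul (σ ^ i)
    refine h4.mono (hmeas i (le_max_of_le_left hi2)) (Eventually.of_forall fun x => ?_)
    simp [hG]
  have key := std_main hn (le_max_right _ _) hGp hG2 m₁ m₂ hm (le_max_left _ _) hG1
  have hv : variance (gd 0) (gam.map (aff μ σ)) = variance (G 0) gam := by
    have h0 : AEMeasurable (gd 0) (gam.map (aff μ σ)) :=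
      (hprim 0 (by omega)).cont.measurable.aemeasurable
    rw [variance_map h0 he.measurable.aemeasurable]
    congr 1
    ext x
    simp [hG]
  rw [hv, snormal_aff μ σ hσ, snormal_aff μ σ hσ, ← isPoly_aff_iff (gd 0) _ μ σ hσ]
  have hG0 : G 0 = fun x => gd 0 (aff μ σ x) := by ext x; simp [hG]
  rw [← hG0]
  exact key

end
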